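/- arXiv:2406.12149 — 3 statements merged into one kernel-verified Lean document; each statement's English description precedes it below -/
import Mathlib

section
/- There exists an absolute constant c > 0 such that for all integers k ≥ 1, n ≥ 3k, w ≥ 1: if there exists a length-n width-w ROBP over alphabet {0,1}^k that computes ApproxCount^par_k[n, n/3], then w ≥ n^{c·k}. -/
open Finset

/-- A length-`n` read-once branching program over alphabet `σ` with outputs in `Out`.
Layer `t` has vertex set `Fin (size t)` (only layers `0, 1, …, n` are relevant);
layer `0` consists of a single start vertex, and each vertex of layer `t` has an
outgoing edge to layer `t+1` for every letter of the alphabet. -/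
structure ROBP (σ Out : Type) (n : ℕ) where
  size : ℕ → ℕ
  size0 : size 0 = 1
  sizePos : ∀ t, 0 < size t
  step : (t : ℕ) → Fin (size t) → σ → Fin (size (t + 1))
  out : Fin (size n) → Out

namespace ROBP

variable {σ Out : Type} {n : ℕ}

/-- The vertex reached in layer `t` on input `x` (only `x 0, …, x (t-1)` matter). -/
def state (P : ROBP σ Out n) (x : ℕ → σ) : (t : ℕ) → Fin (P.size t)
  | 0 => ⟨0, P.sizePos 0⟩
  | t + 1 => P.step t (state P x t) (x t)

/-- The width of an ROBP: the maximal number of vertices in a single layer. -/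
def width (P : ROBP σ Out n) : ℕ := (Finset.range (n + 1)).sup P.size

/-- Every vertex (in the relevant layers) is reached by some input: no useless vertices. -/
def Reachable (P : ROBP σ Out n) : Prop :=
  ∀ t, t ≤ n → ∀ v : Fin (P.size t), ∃ x : ℕ → σ, P.state x t = v

/-- The output of the program on input `x`. -/
def eval (P : ROBP σ Out n) (x : ℕ → σ) : Out := P.out (P.state x n)

end ROBP

/-- The number of occurrences of `j` among `x 0, …, x (t-1)`. -/
def countK {k : ℕ} (x : ℕ → Fin k) (t : ℕ) (j : Fin k) : ℕ :=
  ((Finset.range t).filter fun i => x i = j).card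

/-- `P` computes `ApproxCount_k[n, Δ]`: on every input, each of the `k` outputs estimates
the frequency of the corresponding letter within additive error `Δ`. -/
def ComputesApproxCountK (k n : ℕ) (Δ : ℝ) (P : ROBP (Fin k) (Fin k → ℝ) n) : Prop :=
  ∀ x : ℕ → Fin k, ∀ j : Fin k, |P.eval x j - (countK x n j : ℝ)| ≤ Δ

/-- `P` computes `ApproxCount[n, Δ]` (the `{0,1}` case). -/
def ComputesApproxCount (n : ℕ) (Δ : ℝ) (P : ROBP Bool ℝ n) : Prop :=
  ∀ x : ℕ → Bool, |P.eval x - (((Finset.range n).filter fun i => x i = true).card : ℝ)| ≤ Δ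

/-- The number of `1`'s in coordinate `j` among `x 0, …, x (t-1)`. -/
def countPar {k : ℕ} (x : ℕ → (Fin k → Bool)) (t : ℕ) (j : Fin k) : ℕ :=
  ((Finset.range t).filter fun i => x i j = true).card

/-- `P` computes `ApproxCount^par_k[n, Δ]`. -/
def ComputesApproxCountPar (k n : ℕ) (Δ : ℝ) (P : ROBP (Fin k → Bool) (Fin k → ℝ) n) : Prop :=
  ∀ x : ℕ → (Fin k → Bool), ∀ j : Fin k, |P.eval x j - (countPar x n j : ℝ)| ≤ Δ

/-- The inclusion `[k-1] ⊆ [k]`. -/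
def idx {k : ℕ} (j : Fin (k - 1)) : Fin k := Fin.castLE (Nat.sub_le k 1) j

/-- `a_j(v)`: the minimal possible number of `j`'s in the first `t` input words
reaching the vertex `v` of layer `t`. -/
noncomputable def rectLo {k n : ℕ} (P : ROBP (Fin k) (Fin k → ℝ) n) (t : ℕ)
    (v : Fin (P.size t)) (j : Fin (k - 1)) : ℕ :=
  sInf {c | ∃ x : ℕ → Fin k, P.state x t = v ∧ countK x t (idx j) = c}

/-- `b_j(v)`: the maximal possible number of `j`'s in the first `t` input words
reaching the vertex `v` of layer `t`. -/
noncomputable def rectHi {k n : ℕ} (P : ROBP (Fin k) (Fin k → ℝ) n) (t : ℕ)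
    (v : Fin (P.size t)) (j : Fin (k - 1)) : ℕ :=
  sSup {c | ∃ x : ℕ → Fin k, P.state x t = v ∧ countK x t (idx j) = c}

/-- `a_j(v)` for the `k`-parallel case. -/
noncomputable def parLo {k n : ℕ} (P : ROBP (Fin k → Bool) (Fin k → ℝ) n) (t : ℕ)
    (v : Fin (P.size t)) (j : Fin k) : ℕ :=
  sInf {c | ∃ x : ℕ → (Fin k → Bool), P.state x t = v ∧ countPar x t j = c}

/-- `b_j(v)` for the `k`-parallel case. -/
noncomputable def parHi {k n : ℕ} (P : ROBP (Fin k → Bool) (Fin k → ℝ) n) (t : ℕ)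
    (v : Fin (P.size t)) (j : Fin k) : ℕ :=
  sSup {c | ∃ x : ℕ → (Fin k → Bool), P.state x t = v ∧ countPar x t j = c}

/-- The axis-parallel box `[lo 1, hi 1] × ⋯ × [lo m, hi m]` (as a set of integer points). -/
def rect {m : ℕ} (lo hi : Fin m → ℕ) : Set (Fin m → ℕ) :=
  {y | ∀ j, lo j ≤ y j ∧ y j ≤ hi j}

/-- The potential `φ_t(x)` of the point `x` (k-counter case): the maximum, over all
rectangle labels of layer `t` containing `x`, of `min{Σ_j b_j, t} - Σ_j x_j`. -/
noncomputable def phiK {k n : ℕ} (P : ROBP (Fin k) (Fin k → ℝ) n) (t : ℕ)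
    (x : Fin (k - 1) → ℕ) : ℕ :=
  Finset.univ.sup fun v : Fin (P.size t) =>
    if ∀ j, rectLo P t v j ≤ x j ∧ x j ≤ rectHi P t v j then
      min (∑ j, rectHi P t v j) t - ∑ j, x j
    else 0

/-- `T_{t,k}`: tuples of naturals summing to at most `t`. -/
def Tset (k t : ℕ) : Finset (Fin (k - 1) → ℕ) :=
  (Fintype.piFinset fun _ => Finset.range (t + 1)).filter fun x => ∑ j, x j ≤ t

/-- The total potential `Φ_t` of layer `t` (k-counter case). -/
noncomputable def PhiK {k n : ℕ} (P : ROBP (Fin k) (Fin k → ℝ) n) (t : ℕ) : ℕ :=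
  ∑ x ∈ Tset k t, phiK P t x

/-- The potential `φ_t(x)` of the point `x` (k-parallel case). -/
noncomputable def phiPar {k n : ℕ} (P : ROBP (Fin k → Bool) (Fin k → ℝ) n) (t : ℕ)
    (x : Fin k → ℕ) : ℕ :=
  Finset.univ.sup fun v : Fin (P.size t) =>
    if ∀ j, parLo P t v j ≤ x j ∧ x j ≤ parHi P t v j then
      (∑ j, parHi P t v j) - ∑ j, x j
    else 0

/-- The total potential `Φ_t` of layer `t` (k-parallel case): the sum of `φ_t(x)`
over `x ∈ {0, 1, …, ⌊n/10⌋}^k`. -/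
noncomputable def PhiPar {k n : ℕ} (P : ROBP (Fin k → Bool) (Fin k → ℝ) n) (t : ℕ) : ℕ :=
  ∑ x ∈ Fintype.piFinset (fun _ : Fin k => Finset.range (n / 10 + 1)), phiPar P t x

/-- The generalized binomial coefficient `C(x, m) = x (x-1) ⋯ (x-m+1) / m!`. -/
noncomputable def genChoose (x : ℝ) (m : ℕ) : ℝ :=
  (∏ i ∈ Finset.range m, (x - (i : ℝ))) / (Nat.factorial m : ℝ)

namespace ROBP

variable {σ Out : Type} {n : ℕ}

lemma state_congr (P : ROBP σ Out n) {x y : ℕ → σ} {t : ℕ} (h : ∀ i < t, x i = y i) :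
    P.state x t = P.state y t := by
  induction t with
  | zero => rfl
  | succ t ih => rw [state, state, ih fun i hi => h i (by omega), h t (by omega)]

lemma size_le_width (P : ROBP σ Out n) {t : ℕ} (ht : t ≤ n) : P.size t ≤ P.width :=
  Finset.le_sup (f := P.size) (by simpa [Nat.lt_succ_iff] using ht)

end ROBP

lemma countPar_succ {k : ℕ} (x : ℕ → (Fin k → Bool)) (t : ℕ) (j : Fin k) :
    countPar x (t + 1) j = countPar x t j + if x t j = true then 1 else 0 := by
  simp only [countPar, Finset.card_filter, Finset.sum_range_succ]

lemma countPar_congr {k : ℕ} {x y : ℕ → (Fin k → Bool)} {t : ℕ} (h : ∀ i < t, x i = y i)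
    (j : Fin k) : countPar x t j = countPar y t j := by
  unfold countPar
  congr 1
  refine Finset.filter_congr fun i hi => ?_
  rw [h i (Finset.mem_range.1 hi)]

section Adversary

variable {k n : ℕ} (P : ROBP (Fin k → Bool) (Fin k → ℝ) n)

lemma exists_countPar_eq_parLo (y : ℕ → (Fin k → Bool)) (t : ℕ) (j : Fin k) :
    ∃ x, P.state x t = P.state y t ∧ countPar x t j = parLo P t (P.state y t) j :=
  Nat.sInf_mem (s := {c | ∃ x : ℕ → (Fin k → Bool),
    P.state x t = P.state y t ∧ countPar x t j = c}) ⟨_, y, rfl, rfl⟩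

lemma parLo_le_countPar (y : ℕ → (Fin k → Bool)) (t : ℕ) (j : Fin k) :
    parLo P t (P.state y t) j ≤ countPar y t j :=
  Nat.sInf_le ⟨y, rfl, rfl⟩

lemma parLo_state_succ_le (y : ℕ → (Fin k → Bool)) (t : ℕ) (j : Fin k) :
    parLo P (t + 1) (P.state y (t + 1)) j ≤
      parLo P t (P.state y t) j + if y t j = true then 1 else 0 := by
  obtain ⟨x, hx, hc⟩ := exists_countPar_eq_parLo P y t j
  have hagree : ∀ i < t, Function.update x t (y t) i = x i := fun i hi =>
    Function.update_of_ne hi.ne _ _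
  have hstate : P.state (Function.update x t (y t)) (t + 1) = P.state y (t + 1) := by
    rw [ROBP.state, ROBP.state, P.state_congr hagree, hx, Function.update_self]
  rw [← hstate, ← hc, ← countPar_congr hagree]
  refine (parLo_le_countPar P _ _ j).trans_eq ?_
  rw [countPar_succ, Function.update_self]

/-- The run of `P` on the input whose `j`-th bit at time `t` is `1` exactly when the
lower end `a_j` of the current vertex is below the target `x j`. -/
noncomputable def chaseState (x : Fin k → ℕ) : (t : ℕ) → Fin (P.size t)
  | 0 => ⟨0, P.sizePos 0⟩
  | t + 1 => P.step t (chaseState x t) fun j => decide (parLo P t (chaseState x t) j < x j)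

/-- The input driving `chaseState`. -/
noncomputable def chaseInput (x : Fin k → ℕ) (t : ℕ) : Fin k → Bool :=
  fun j => decide (parLo P t (chaseState P x t) j < x j)

lemma state_chaseInput (x : Fin k → ℕ) (t : ℕ) :
    P.state (chaseInput P x) t = chaseState P x t := by
  induction t with
  | zero => rfl
  | succ t ih => rw [ROBP.state, ih]; rfl

lemma parLo_chaseState_le (x : Fin k → ℕ) (t : ℕ) (j : Fin k) :
    parLo P t (chaseState P x t) j ≤ x j := by
  induction t with
  | zero =>
    rw [← state_chaseInput]
    exact (parLo_le_countPar P _ 0 j).trans (by simp [countPar])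
  | succ t ih =>
    have h := parLo_state_succ_le P (chaseInput P x) t j
    rw [state_chaseInput, state_chaseInput] at h
    simp only [chaseInput, decide_eq_true_eq] at h
    split_ifs at h <;> omega

lemma countPar_chaseInput_add (x : Fin k → ℕ) (t : ℕ) (j : Fin k) :
    countPar (chaseInput P x) t j +
      #{i ∈ Finset.range t | x j = parLo P i (chaseState P x i) j} = t := by
  have h := Finset.card_filter_add_card_filter_not (s := Finset.range t)
    (fun i => chaseInput P x i j = true)
  rw [Finset.card_range] at h
  refine Eq.trans ?_ h
  rw [countPar]
  congr 2
  ext i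
  have := parLo_chaseState_le P x i j
  simp only [Finset.mem_filter, chaseInput, decide_eq_true_eq, and_congr_right_iff]
  omega

variable {P}

lemma abs_countPar_sub_le {Δ : ℝ} (hP : ComputesApproxCountPar k n Δ P)
    {x y : ℕ → (Fin k → Bool)} (h : P.state x n = P.state y n) (j : Fin k) :
    |(countPar x n j : ℝ) - countPar y n j| ≤ 2 * Δ := by
  have hx := hP x j
  have hy := hP y j
  rw [ROBP.eval, h] at hx
  rw [ROBP.eval] at hy
  rw [abs_le] at *
  constructor <;> linarith

lemma le_card_eq_parLo {Δ : ℝ} (hP : ComputesApproxCountPar k n Δ P) (x : Fin k → ℕ)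
    (j : Fin k) :
    (n : ℝ) - 2 * Δ - x j ≤ #{i ∈ Finset.range n | x j = parLo P i (chaseState P x i) j} := by
  obtain ⟨y, hy, hc⟩ := exists_countPar_eq_parLo P (chaseInput P x) n j
  have h := abs_le.1 (abs_countPar_sub_le hP hy.symm j)
  have hle : countPar y n j ≤ x j := by
    rw [hc, state_chaseInput]
    exact parLo_chaseState_le P x n j
  have hadd : (countPar (chaseInput P x) n j : ℝ) +
      #{i ∈ Finset.range n | x j = parLo P i (chaseState P x i) j} = n := by
    exact_mod_cast countPar_chaseInput_add P x n j
  have hle' : (countPar y n j : ℝ) ≤ x j := by exact_mod_cast hle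
  linarith [h.2]

lemma two_pow_le_width {Δ : ℝ} (hP : ComputesApproxCountPar k n Δ P) (hΔ : 2 * Δ < n) :
    2 ^ k ≤ P.width := by
  have hinj : Function.Injective fun s : Fin k → Bool => P.state (fun _ => s) n := by
    intro s s' h
    funext j
    have hj := abs_le.1 (abs_countPar_sub_le hP h j)
    by_contra hne
    cases hs : s j <;> cases hs' : s' j <;> simp_all [countPar] <;> linarith
  calc 2 ^ k = Fintype.card (Fin k → Bool) := by simp
    _ ≤ Fintype.card (Fin (P.size n)) := Fintype.card_le_of_injective _ hinj
    _ = P.size n := Fintype.card_fin _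
    _ ≤ P.width := P.size_le_width le_rfl

end Adversary

lemma sum_pow_card_agree_le {k N : ℕ} (a : Fin k → ℕ) :
    ∑ x : Fin k → Fin N, N ^ #{j | (x j : ℕ) = a j} ≤ (2 * N) ^ k := by
  calc ∑ x : Fin k → Fin N, N ^ #{j | (x j : ℕ) = a j}
      = ∑ x : Fin k → Fin N, ∏ j, if (x j : ℕ) = a j then N else 1 := by
        simp [Finset.prod_ite]
    _ = ∏ j, ∑ i : Fin N, if (i : ℕ) = a j then N else 1 :=
        (Fintype.prod_sum fun j (i : Fin N) => if (i : ℕ) = a j then N else 1).symm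
    _ ≤ ∏ _j : Fin k, (2 * N) := Finset.prod_le_prod' fun j _ => by
        have hcard : #{i : Fin N | (i : ℕ) = a j} ≤ 1 :=
          Finset.card_le_one.2 fun i hi i' hi' => by simp at hi hi'; omega
        have hcard' : #{i : Fin N | ¬ (i : ℕ) = a j} ≤ N :=
          (Finset.card_le_univ _).trans_eq (Fintype.card_fin N)
        simp only [Finset.sum_ite, Finset.sum_const, smul_eq_mul, mul_one]
        nlinarith
    _ = (2 * N) ^ k := by simp

lemma sum_pow_card_agree_chaseState_le {k n : ℕ} (P : ROBP (Fin k → Bool) (Fin k → ℝ) n)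
    (N t : ℕ) :
    ∑ x : Fin k → Fin N, N ^ #{j | (x j : ℕ) = parLo P t (chaseState P (fun j => x j) t) j} ≤
      P.size t * (2 * N) ^ k := by
  calc _ ≤ ∑ x : Fin k → Fin N, ∑ v : Fin (P.size t), N ^ #{j | (x j : ℕ) = parLo P t v j} :=
        Finset.sum_le_sum fun x _ => Finset.single_le_sum
          (f := fun v => N ^ #{j | (x j : ℕ) = parLo P t v j}) (fun _ _ => Nat.zero_le _)
          (Finset.mem_univ (chaseState P (fun j => x j) t))
    _ = ∑ v : Fin (P.size t), ∑ x : Fin k → Fin N, N ^ #{j | (x j : ℕ) = parLo P t v j} :=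
        Finset.sum_comm
    _ ≤ ∑ _v : Fin (P.size t), (2 * N) ^ k :=
        Finset.sum_le_sum fun v _ => sum_pow_card_agree_le _
    _ = _ := by simp

lemma card_mul_rpow_le_sum_pow {ι : Type*} (s : Finset ι) (m : ι → ℕ) {z μ : ℝ} (hz : 1 ≤ z)
    (h : #s * μ ≤ ∑ i ∈ s, (m i : ℝ)) : #s * z ^ μ ≤ ∑ i ∈ s, z ^ m i := by
  have hz0 : 0 < z := by linarith
  have hterm : ∀ i ∈ s, z ^ μ * (1 + (m i - μ) * Real.log z) ≤ z ^ m i := fun i _ => by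
    calc z ^ μ * (1 + (m i - μ) * Real.log z)
        ≤ z ^ μ * Real.exp (Real.log z * (m i - μ)) := by
          gcongr
          linarith [Real.add_one_le_exp (Real.log z * (m i - μ))]
      _ = z ^ m i := by
          rw [← Real.rpow_def_of_pos hz0, ← Real.rpow_add hz0, add_sub_cancel, Real.rpow_natCast]
  refine le_trans ?_ (Finset.sum_le_sum hterm)
  rw [← Finset.mul_sum, Finset.sum_add_distrib, ← Finset.sum_mul, Finset.sum_sub_distrib,
    mul_comm]
  simp only [Finset.sum_const, nsmul_eq_mul, mul_one]
  gcongr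
  nlinarith [Real.log_nonneg hz]

lemma rpow_le_width_mul_two_pow {k n : ℕ} (hn : 0 < n) {P : ROBP (Fin k → Bool) (Fin k → ℝ) n}
    (hP : ComputesApproxCountPar k n ((n : ℝ) / 3) P) :
    ((n / 6 + 1 : ℕ) : ℝ) ^ ((k : ℝ) / 6) ≤ P.width * 2 ^ k := by
  set N := n / 6 + 1 with hN
  have hN0 : (0 : ℝ) < N := by positivity
  have hn0 : (0 : ℝ) < n := by exact_mod_cast hn
  let m : (Fin k → Fin N) × ℕ → ℕ := fun p =>
    #{j | (p.1 j : ℕ) = parLo P p.2 (chaseState P (fun j => p.1 j) p.2) j}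
  have hsum : ∀ x : Fin k → Fin N, (n : ℝ) * (k / 6) ≤ ∑ t ∈ Finset.range n, (m (x, t) : ℝ) := by
    intro x
    have hswap : ∑ t ∈ Finset.range n, (m (x, t) : ℝ) =
        ∑ j, (#{t ∈ Finset.range n |
          (x j : ℕ) = parLo P t (chaseState P (fun j => x j) t) j} : ℝ) := by
      simp only [m, Finset.card_filter]
      push_cast
      exact Finset.sum_comm
    rw [hswap]
    calc (n : ℝ) * (k / 6) = ∑ _j : Fin k, (n : ℝ) / 6 := by simp; ring
      _ ≤ _ := Finset.sum_le_sum fun j _ => by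
          have h := le_card_eq_parLo hP (fun j => (x j : ℕ)) j
          have hx : ((x j : ℕ) : ℝ) * 6 ≤ n := by
            have := (x j).isLt
            exact_mod_cast (by omega : (x j : ℕ) * 6 ≤ n)
          refine le_trans ?_ h
          linarith
  have hcard : (#((Finset.univ : Finset (Fin k → Fin N)) ×ˢ Finset.range n) : ℝ) = N ^ k * n := by
    simp
  have hlow := card_mul_rpow_le_sum_pow
    ((Finset.univ : Finset (Fin k → Fin N)) ×ˢ Finset.range n) m (z := N) (μ := k / 6)
    (by exact_mod_cast Nat.succ_pos _) (by
      rw [hcard, Finset.sum_product]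
      calc (N : ℝ) ^ k * n * (k / 6) = ∑ _x : Fin k → Fin N, (n : ℝ) * (k / 6) := by simp; ring
        _ ≤ _ := Finset.sum_le_sum fun x _ => hsum x)
  have hup : ∑ p ∈ (Finset.univ : Finset (Fin k → Fin N)) ×ˢ Finset.range n, (N : ℝ) ^ m p ≤
      n * (P.width * (2 * N) ^ k) := by
    rw [Finset.sum_product_right]
    calc _ ≤ ∑ _t ∈ Finset.range n, (P.width * (2 * N) ^ k : ℝ) :=
          Finset.sum_le_sum fun t ht => by
            exact_mod_cast (sum_pow_card_agree_chaseState_le P N t).trans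
              (Nat.mul_le_mul_right _ (P.size_le_width (Finset.mem_range.1 ht).le))
      _ = _ := by simp
  rw [hcard] at hlow
  have hpos : (0 : ℝ) < N ^ k * n := by positivity
  refine le_of_mul_le_mul_left ((hlow.trans hup).trans_eq ?_) hpos
  rw [mul_pow]
  ring

/-- there is an absolute constant `c > 0` such that for all `k ≥ 1`,
`n ≥ 3k`, `w ≥ 1`: if a length-`n` width-`w` ROBP over `{0,1}^k` computes
`ApproxCount^par_k[n, n/3]`, then `w ≥ n^{c·k}`. -/
theorem stmt9 :
    ∃ c : ℝ, 0 < c ∧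
      ∀ k n w : ℕ, 1 ≤ k → 3 * k ≤ n → 1 ≤ w →
        (∃ P : ROBP (Fin k → Bool) (Fin k → ℝ) n, P.Reachable ∧ P.width ≤ w ∧
          ComputesApproxCountPar k n ((n : ℝ) / 3) P) →
        (w : ℝ) ≥ (n : ℝ) ^ (c * (k : ℝ)) := by
  refine ⟨1 / 15, by norm_num, ?_⟩
  rintro k n w hk hkn - ⟨P, -, hw, hP⟩
  have hn : 0 < n := by omega
  have hn0 : (0 : ℝ) < n := by exact_mod_cast hn
  have hw' : (P.width : ℝ) ≤ w := by exact_mod_cast hw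
  have htwo : (2 : ℝ) ^ k ≤ w := by
    exact_mod_cast (two_pow_le_width hP (by linarith)).trans hw
  have hroot : ((n : ℝ) / 6) ^ ((k : ℝ) / 6) ≤ w * 2 ^ k := by
    refine le_trans ?_ ((rpow_le_width_mul_two_pow hn hP).trans (by gcongr))
    gcongr
    rw [div_le_iff₀ (by norm_num)]
    exact_mod_cast (by omega : n ≤ (n / 6 + 1) * 6)
  have hsix : ((n : ℝ) / 6) ^ k ≤ w ^ 6 * 64 ^ k := by
    calc ((n : ℝ) / 6) ^ k = (((n : ℝ) / 6) ^ ((k : ℝ) / 6)) ^ 6 := by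
          rw [← Real.rpow_natCast _ 6, ← Real.rpow_mul (by positivity), ← Real.rpow_natCast _ k]
          congr 1
          push_cast
          ring
      _ ≤ (w * 2 ^ k) ^ 6 := by gcongr
      _ = w ^ 6 * 64 ^ k := by
          rw [mul_pow, pow_right_comm]
          norm_num
  have hfifteen : (n : ℝ) ^ k ≤ w ^ 15 := by
    calc (n : ℝ) ^ k = (n / 6 : ℝ) ^ k * 6 ^ k := by rw [← mul_pow]; congr 1; ring
      _ ≤ w ^ 6 * 64 ^ k * 6 ^ k := by gcongr
      _ = w ^ 6 * 384 ^ k := by rw [mul_assoc, ← mul_pow]; norm_num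
      _ ≤ w ^ 6 * 512 ^ k := by gcongr; norm_num
      _ = w ^ 6 * (2 ^ k) ^ 9 := by rw [pow_right_comm]; norm_num
      _ ≤ w ^ 6 * w ^ 9 := by gcongr
      _ = w ^ 15 := by ring
  refine le_of_pow_le_pow_left₀ (n := 15) (by norm_num) (by positivity) ?_
  calc ((n : ℝ) ^ (1 / 15 * (k : ℝ))) ^ 15 = (n : ℝ) ^ k := by
        rw [← Real.rpow_natCast _ 15, ← Real.rpow_mul hn0.le, ← Real.rpow_natCast _ k]
        congr 1
        push_cast
        ring
    _ ≤ w ^ 15 := hfifteen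
end

section
/- For all integers n ≥ 1 and 3 ≤ w ≤ n/10, there exists a length-n ROBP over the alphabet {0,1} of width at most w that computes ApproxCount[n, n/2 − √(nw)/20]. -/
open Finset

/-- The number of occurrences of `c` among `x 0, …, x (t-1)`. -/
def letterCount (c : Bool) (x : ℕ → Bool) (t : ℕ) : ℕ :=
  ((Finset.range t).filter fun i => x i = c).card

lemma letterCount_zero (c : Bool) (x : ℕ → Bool) : letterCount c x 0 = 0 := by
  simp [letterCount]

lemma letterCount_succ (c : Bool) (x : ℕ → Bool) (t : ℕ) :
    letterCount c x (t + 1) = letterCount c x t + if x t = c then 1 else 0 := by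
  unfold letterCount
  rw [Finset.range_add_one, Finset.filter_insert]
  split_ifs with h <;> simp

lemma letterCount_not (c : Bool) (x : ℕ → Bool) (t : ℕ) :
    letterCount c (fun i => !x i) t = letterCount (!c) x t := by
  unfold letterCount
  congr 1
  ext i
  cases c <;> simp

lemma letterCount_add (x : ℕ → Bool) (t : ℕ) :
    letterCount true x t + letterCount false x t = t := by
  induction t with
  | zero => simp [letterCount_zero]
  | succ t ih =>
    rw [letterCount_succ, letterCount_succ]
    cases x t <;> simp <;> omega

/-- The state after `t` steps of the time-dependent automaton `δ` started at `v₀`. -/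
def runState (δ : ℕ → ℕ → Bool → ℕ) (v₀ : ℕ) (x : ℕ → Bool) : ℕ → ℕ
  | 0 => v₀
  | t + 1 => δ t (runState δ v₀ x t) (x t)

lemma runState_lt {w : ℕ} {δ : ℕ → ℕ → Bool → ℕ} {v₀ : ℕ} (hv : v₀ < w)
    (hδ : ∀ t v c, v < w → δ t v c < w) (x : ℕ → Bool) (t : ℕ) : runState δ v₀ x t < w := by
  induction t with
  | zero => exact hv
  | succ t ih => exact hδ _ _ _ ih

lemma runState_congr {δ δ' : ℕ → ℕ → Bool → ℕ} {v₀ : ℕ} {x y : ℕ → Bool} {t : ℕ}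
    (hδ : ∀ s < t, δ s = δ' s) (hxy : ∀ s < t, x s = y s) :
    runState δ v₀ x t = runState δ' v₀ y t := by
  induction t with
  | zero => rfl
  | succ t ih =>
    simp only [runState]
    rw [ih (fun s hs => hδ s (by omega)) (fun s hs => hxy s (by omega)),
      hδ t (by omega), hxy t (by omega)]

/-- Discarding the unreachable states of a time-dependent automaton on `w` states yields an ROBP
of width at most `w` with the same outputs. -/
lemma exists_robp_of_automaton {Out : Type} {w : ℕ} (n : ℕ) {δ : ℕ → ℕ → Bool → ℕ} {v₀ : ℕ}
    (hv : v₀ < w) (hδ : ∀ t v c, v < w → δ t v c < w) (out : ℕ → Out) :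
    ∃ P : ROBP Bool Out n, P.Reachable ∧ P.width ≤ w ∧
      ∀ x, P.eval x = out (runState δ v₀ x n) := by
  classical
  let R : ℕ → Finset ℕ := fun t =>
    (Finset.range w).filter fun v => ∃ x, runState δ v₀ x t = v
  have hR : ∀ x t, runState δ v₀ x t ∈ R t := fun x t => by
    simp only [R, Finset.mem_filter, Finset.mem_range]
    exact ⟨runState_lt hv hδ x t, x, rfl⟩
  have hstep : ∀ t (v : R t) (c : Bool), δ t v c ∈ R (t + 1) := by
    rintro t ⟨v, hvR⟩ c
    obtain ⟨-, x, hx⟩ := Finset.mem_filter.1 hvR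
    convert hR (Function.update x t c) (t + 1) using 1
    simp only [runState, Function.update_self]
    congr 1
    rw [← hx]
    exact runState_congr (fun _ _ => rfl)
      (fun s hs => (Function.update_of_ne (by omega) _ _).symm)
  let P : ROBP Bool Out n :=
    { size := fun t => (R t).card
      size0 := by
        rw [Finset.card_eq_one]
        refine ⟨v₀, ?_⟩
        ext v
        simp only [R, runState, Finset.mem_filter, Finset.mem_range, Finset.mem_singleton,
          exists_const]
        constructor
        · rintro ⟨-, h⟩
          exact h.symm
        · rintro rfl
          exact ⟨hv, rfl⟩
      sizePos := fun t => Finset.card_pos.2 ⟨_, hR (fun _ => false) t⟩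
      step := fun t v c =>
        (R (t + 1)).equivFin ⟨δ t ((R t).equivFin.symm v) c, hstep t ((R t).equivFin.symm v) c⟩
      out := fun v => out ((R n).equivFin.symm v) }
  have hstate : ∀ x t, P.state x t = (R t).equivFin ⟨runState δ v₀ x t, hR x t⟩ := by
    intro x t
    induction t with
    | zero =>
      have : Subsingleton (Fin (P.size 0)) := by
        rw [P.size0]
        infer_instance
      exact Subsingleton.elim (α := Fin (P.size 0)) _ _
    | succ t ih =>
      change P.step t (P.state x t) (x t) = _
      rw [ih]
      simp [P, runState]
  refine ⟨P, ?_, ?_, ?_⟩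
  · intro t _ v
    obtain ⟨-, x, hx⟩ := Finset.mem_filter.1 ((R t).equivFin.symm v).2
    refine ⟨x, ?_⟩
    rw [hstate, ← (R t).equivFin.apply_symm_apply v]
    congr 1
    exact Subtype.ext hx
  · refine Finset.sup_le fun t _ => ?_
    exact (Finset.card_filter_le _ _).trans (Finset.card_range w).le
  · intro x
    change out ((R n).equivFin.symm (P.state x n)) = _
    rw [hstate, Equiv.symm_apply_apply]

/-- Some automaton on the states `0, …, w - 1` has the property that every input reaching the
state `v` at time `t` contains at least `a v` ones and at least `b v` zeros up to that time. -/
def CountBounds (w t : ℕ) (a b : ℕ → ℕ) : Prop :=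
  ∃ (δ : ℕ → ℕ → Bool → ℕ) (v₀ : ℕ), v₀ < w ∧ (∀ t v c, v < w → δ t v c < w) ∧
    ∀ x, a (runState δ v₀ x t) ≤ letterCount true x t ∧
      b (runState δ v₀ x t) ≤ letterCount false x t

namespace CountBounds

variable {w t : ℕ} {a b a' b' : ℕ → ℕ}

lemma initial (hw : 0 < w) (ha : a 0 = 0) (hb : b 0 = 0) : CountBounds w 0 a b :=
  ⟨fun _ v _ => v, 0, hw, fun _ _ _ h => h, fun x => by simp [runState, letterCount_zero, ha, hb]⟩

lemma step (h : CountBounds w t a b) (f : ℕ → Bool → ℕ)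
    (htrue : ∀ v < w, f v true < w ∧ a' (f v true) ≤ a v + 1 ∧ b' (f v true) ≤ b v)
    (hfalse : ∀ v < w, f v false < w ∧ a' (f v false) ≤ a v ∧ b' (f v false) ≤ b v + 1) :
    CountBounds w (t + 1) a' b' := by
  obtain ⟨δ, v₀, hv, hδ, hx⟩ := h
  refine ⟨Function.update δ t f, v₀, hv, ?_, ?_⟩
  · intro s v c hvw
    rcases eq_or_ne s t with rfl | hs
    · rw [Function.update_self]
      cases c
      · exact (hfalse v hvw).1
      · exact (htrue v hvw).1
    · rw [Function.update_of_ne hs]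
      exact hδ s v c hvw
  · intro x
    have hrun : runState (Function.update δ t f) v₀ x t = runState δ v₀ x t :=
      runState_congr (fun s hs => Function.update_of_ne (by omega) _ _) (fun _ _ => rfl)
    have hlt := runState_lt hv hδ x t
    obtain ⟨h1, h2⟩ := hx x
    simp only [runState, Function.update_self, hrun, letterCount_succ]
    cases x t
    · have := hfalse _ hlt
      simp only [Bool.false_eq_true, if_false, if_true]
      omega
    · have := htrue _ hlt
      simp only [Bool.true_eq_false, if_false, if_true]
      omega

lemma mono (h : CountBounds w t a b) (ha : ∀ v < w, a' v ≤ a v) (hb : ∀ v < w, b' v ≤ b v) :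
    CountBounds w t a' b' := by
  obtain ⟨δ, v₀, hv, hδ, hx⟩ := h
  exact ⟨δ, v₀, hv, hδ, fun x => ⟨(ha _ (runState_lt hv hδ x t)).trans (hx x).1,
    (hb _ (runState_lt hv hδ x t)).trans (hx x).2⟩⟩

lemma extend (h : CountBounds w t a b) {t' : ℕ} (ht : t ≤ t') : CountBounds w t' a b := by
  induction t', ht using Nat.le_induction with
  | base => exact h
  | succ t' _ ih =>
    exact ih.step (fun v _ => v) (fun v hv => ⟨hv, by omega, by omega⟩)
      (fun v hv => ⟨hv, by omega, by omega⟩)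

/-- Exchanging the two letters and reversing the order of the states. -/
lemma reflect (h : CountBounds w t a b) :
    CountBounds w t (fun v => b (w - 1 - v)) (fun v => a (w - 1 - v)) := by
  obtain ⟨δ, v₀, hv, hδ, hx⟩ := h
  have hrun : ∀ x s, runState (fun s v c => w - 1 - δ s (w - 1 - v) (!c)) (w - 1 - v₀) x s =
      w - 1 - runState δ v₀ (fun i => !x i) s := by
    intro x s
    induction s with
    | zero => rfl
    | succ s ih =>
      have := runState_lt hv hδ (fun i => !x i) s
      simp only [runState, ih]
      congr 2
      omega
  refine ⟨fun s v c => w - 1 - δ s (w - 1 - v) (!c), w - 1 - v₀, by omega,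
    fun s v c hvw => (Nat.sub_le _ _).trans_lt (by omega), fun x => ?_⟩
  have hlt := runState_lt hv hδ (fun i => !x i) t
  have h2 := hx fun i => !x i
  have heq : w - 1 - (w - 1 - runState δ v₀ (fun i => !x i) t) =
    runState δ v₀ (fun i => !x i) t := by omega
  simp only [hrun, heq]
  rw [letterCount_not, letterCount_not] at h2
  exact ⟨h2.2, h2.1⟩

/-- The staircase configuration on `k + 2` states: the state `v ≤ k` guarantees `v` ones and
`S - v` zeros, and the last state guarantees `T` ones. -/
def Staircase (k t S T : ℕ) : Prop :=
  CountBounds (k + 2) t (fun v => if v ≤ k then v else T) (fun v => if v ≤ k then S - v else 0)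

lemma staircase_initial (k : ℕ) : Staircase k (k + 1) (k + 1) (k + 1) := by
  have key : ∀ t ≤ k + 1, CountBounds (k + 2) t (fun v => v) (fun v => t - v) := by
    intro t
    induction t with
    | zero => exact fun _ => initial (by omega) rfl rfl
    | succ t ih =>
      intro ht
      refine (ih (by omega)).step
        (fun v c => if c = true ∧ v ≤ k then v + 1 else v) (fun v hv => ?_) (fun v hv => ?_)
      · simp only [true_and]
        split_ifs <;> omega
      · simp only [Bool.false_eq_true, false_and, if_false]
        omega
  refine (key (k + 1) le_rfl).mono (fun v hv => ?_) (fun v hv => ?_)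
  · split_ifs <;> omega
  · split_ifs <;> omega

/-- The intermediate states accumulate ones while the zeros they require stay fixed. -/
lemma Staircase.shift {k t S T : ℕ} (h : Staircase k t S T) (r : ℕ) :
    CountBounds (k + 2) (t + r) (fun v => if v = 0 then 0 else if v ≤ k then v + r else T)
      (fun v => if v ≤ k then S - v else 0) := by
  induction r with
  | zero =>
    refine h.mono (fun v hv => ?_) (fun v hv => le_rfl)
    split_ifs <;> omega
  | succ r ih =>
    refine ih.step (fun v c => if c = false ∧ v ≤ k then v - 1 else v)
      (fun v hv => ?_) (fun v hv => ?_)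
    · simp only [Bool.true_eq_false, false_and, if_false]
      split_ifs <;> omega
    · simp only [true_and]
      split_ifs <;> omega

/-- The last state accumulates ones while the staircase is rebuilt downwards from it. -/
lemma Staircase.rebuild {k t S T : ℕ} (h : Staircase k t S T) (hS : k + 1 ≤ S) {i : ℕ}
    (hi : i ≤ k) :
    CountBounds (k + 2) (t + (T + k) + i)
      (fun v => if v = 0 then 0 else if k + 1 - v ≤ i then T + i - (k + 1 - v) else T + k)
      (fun v => if v = 0 then S else k + 1 - v) := by
  induction i with
  | zero =>
    refine (h.shift (T + k)).mono (fun v hv => ?_) (fun v hv => ?_)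
    · split_ifs <;> omega
    · split_ifs <;> omega
  | succ i ih =>
    refine (ih (by omega)).step (fun v c => if c = false ∧ 2 ≤ v then v - 1 else v)
      (fun v hv => ?_) (fun v hv => ?_)
    · simp only [Bool.true_eq_false, false_and, if_false]
      split_ifs <;> omega
    · simp only [true_and]
      split_ifs <;> omega

lemma Staircase.half_cycle {k t S T : ℕ} (h : Staircase k t S T) (hS : k + 1 ≤ S) :
    Staircase k (t + (T + 2 * k)) (T + k) S := by
  have := (h.rebuild hS le_rfl).reflect
  rw [show t + (T + 2 * k) = t + (T + k) + k by omega]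
  refine this.mono (fun v hv => ?_) (fun v hv => ?_)
  · split_ifs <;> omega
  · split_ifs <;> omega

lemma Staircase.cycle {k t S : ℕ} (h : Staircase k t S S) (hS : k + 1 ≤ S) :
    Staircase k (t + (2 * S + 4 * k)) (S + k) (S + k) := by
  have := (h.half_cycle hS).half_cycle (by omega)
  rwa [show t + (S + 2 * k) + (S + 2 * k) = t + (2 * S + 4 * k) by omega] at this

lemma staircase_iterate (k c : ℕ) :
    Staircase k (k + 1 + c * (5 * k + 2) + k * c ^ 2) ((c + 1) * k + 1) ((c + 1) * k + 1) := by
  induction c with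
  | zero => simpa using staircase_initial k
  | succ c ih =>
    have := ih.cycle (by nlinarith [Nat.zero_le (c * k)])
    convert this using 1 <;> ring

end CountBounds

/-- for all `n ≥ 1` and `3 ≤ w ≤ n/10`, there is a length-`n` ROBP over
`{0,1}` of width at most `w` computing `ApproxCount[n, n/2 - √(nw)/20]`. -/
theorem stmt14 (n w : ℕ) (hn : 1 ≤ n) (hw3 : 3 ≤ w) (hw10 : 10 * w ≤ n) :
    ∃ P : ROBP Bool ℝ n, P.Reachable ∧ P.width ≤ w ∧
      ComputesApproxCount n ((n : ℝ) / 2 - Real.sqrt ((n : ℝ) * (w : ℝ)) / 20) P := by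
  obtain ⟨k, rfl⟩ : ∃ k, w = k + 2 := ⟨w - 2, by omega⟩
  have hk : 1 ≤ k := by omega
  let τ : ℕ → ℕ := fun c => k + 1 + c * (5 * k + 2) + k * c ^ 2
  obtain ⟨c, hc, hc'⟩ : ∃ c, τ c ≤ n ∧ n < τ (c + 1) := by
    by_contra! hcon
    have hle : ∀ c, τ c ≤ n := by
      intro c
      induction c with
      | zero => simp only [τ]; omega
      | succ c ih => exact hcon c ih
    have := hle n
    simp only [τ] at this
    nlinarith [Nat.zero_le (n * k), Nat.zero_le (k * n ^ 2)]
  set S := (c + 1) * k + 1 with hS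
  have hnw : n * (k + 2) ≤ 100 * S ^ 2 := by
    have h1 : n ≤ 10 * (k * (c + 1) ^ 2) := by
      simp only [τ] at hc'
      nlinarith [Nat.mul_le_mul_right (c + 1) hk, Nat.zero_le (k * c), Nat.zero_le (k * c ^ 2)]
    calc n * (k + 2) ≤ 10 * (k * (c + 1) ^ 2) * (3 * k) := Nat.mul_le_mul h1 (by omega)
      _ = 30 * ((c + 1) * k) ^ 2 := by ring
      _ ≤ 100 * S ^ 2 := Nat.mul_le_mul (by omega) (Nat.pow_le_pow_left (by omega) 2)
  have hsqrt : Real.sqrt ((n : ℝ) * ((k + 2 : ℕ) : ℝ)) ≤ 10 * S := by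
    rw [Real.sqrt_le_left (by positivity)]
    have : (n : ℝ) * ((k + 2 : ℕ) : ℝ) ≤ 100 * (S : ℝ) ^ 2 := by exact_mod_cast hnw
    linarith
  have hSk : k + 1 ≤ S := by
    rw [hS]
    nlinarith [Nat.zero_le (c * k)]
  obtain ⟨δ, v₀, hv, hδ, hx⟩ := (CountBounds.staircase_iterate k c).extend hc
  let a : ℕ → ℕ := fun v => if v ≤ k then v else S
  let b : ℕ → ℕ := fun v => if v ≤ k then S - v else 0
  obtain ⟨P, hreach, hwidth, heval⟩ :=
    exists_robp_of_automaton n hv hδ fun v => ((a v : ℝ) + n - b v) / 2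
  refine ⟨P, hreach, hwidth, fun x => ?_⟩
  rw [heval]
  change |_ - (letterCount true x n : ℝ)| ≤ _
  obtain ⟨h1, h2⟩ := hx x
  have hsum : (letterCount true x n : ℝ) + letterCount false x n = n := by
    exact_mod_cast letterCount_add x n
  generalize runState δ v₀ x n = v at *
  have hab : S ≤ a v + b v := by
    simp only [a, b]
    split_ifs <;> omega
  have h1' : (a v : ℝ) ≤ letterCount true x n := by exact_mod_cast h1
  have h2' : (b v : ℝ) ≤ letterCount false x n := by exact_mod_cast h2
  have hab' : (S : ℝ) ≤ a v + b v := by exact_mod_cast hab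
  rw [abs_le]
  constructor <;> linarith
end

section
/- There exists an absolute constant c > 0 such that for all integers k ≥ 2, n ≥ 10k and every real Δ with 10 ≤ Δ ≤ n/10, there exists a length-n ROBP over alphabet [k] that computes ApproxCount_k[n,Δ] and has width at most C(n + k − 1 − c·√(nΔ), k−1), where C(x,k−1) denotes the generalized binomial coefficient x(x−1)⋯(x−k+2)/(k−1)! for a real x. -/
open Finset

namespace ROBP

variable {σ Out α : Type} {n : ℕ}

/-- The state after `t` steps of the machine with transition function `step` started at `init`. -/
def run (step : ℕ → α → σ → α) (init : α) (x : ℕ → σ) : ℕ → α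
  | 0 => init
  | t + 1 => step t (run step init x t) (x t)

lemma run_congr (step : ℕ → α → σ → α) (init : α) {x y : ℕ → σ} {t : ℕ}
    (h : ∀ i < t, x i = y i) : run step init x t = run step init y t := by
  induction t with
  | zero => rfl
  | succ t ih =>
    simp only [run]
    rw [ih fun i hi => h i (by omega), h t (by omega)]

lemma run_update (step : ℕ → α → σ → α) (init : α) (x : ℕ → σ) (t : ℕ) (j : σ) :
    run step init (Function.update x t j) (t + 1) = step t (run step init x t) j := by
  simp only [run, Function.update_self]
  congr 1
  exact run_congr _ _ fun i hi => Function.update_of_ne hi.ne _ _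

lemma finite_range_run [Finite σ] (step : ℕ → α → σ → α) (init : α) (t : ℕ) :
    (Set.range fun x => run step init x t).Finite := by
  induction t with
  | zero => exact (Set.finite_singleton init).subset (by rintro _ ⟨x, rfl⟩; rfl)
  | succ t ih =>
    refine (Set.Finite.image2 (step t) ih Set.finite_univ).subset ?_
    rintro _ ⟨x, rfl⟩
    exact ⟨_, ⟨x, rfl⟩, x t, trivial, rfl⟩

/-- Every machine over a finite alphabet unrolls to a branching program whose layers are the
sets of reachable states. -/
theorem exists_of_run [Finite σ] [Nonempty σ] (step : ℕ → α → σ → α) (init : α) (out : α → Out) :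
    ∃ P : ROBP σ Out n, P.Reachable ∧ (∀ x, P.eval x = out (run step init x n)) ∧
      ∀ t, P.size t = (Set.range fun x => run step init x t).ncard := by
  let L : ℕ → Set α := fun t => Set.range fun x => run step init x t
  have hfin : ∀ t, Finite (L t) := fun t => (finite_range_run step init t).to_subtype
  have hne : ∀ t, Nonempty (L t) := fun t =>
    ⟨⟨_, fun _ => Classical.arbitrary σ, rfl⟩⟩
  have hstep : ∀ t (v : L t) (j : σ), step t v j ∈ L (t + 1) := by
    rintro t ⟨_, x, rfl⟩ j
    exact ⟨_, run_update step init x t j⟩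
  let e : ∀ t, L t ≃ Fin (Nat.card (L t)) := fun t => Finite.equivFin (L t)
  have h0 : Nat.card (L 0) = 1 := by
    have : Subsingleton (L 0) := ⟨by rintro ⟨_, x, rfl⟩ ⟨_, y, rfl⟩; rfl⟩
    exact Nat.card_of_subsingleton (Classical.arbitrary (L 0))
  let P : ROBP σ Out n :=
    { size := fun t => Nat.card (L t)
      size0 := h0
      sizePos := fun t => Nat.card_pos
      step := fun t v j => e (t + 1) ⟨_, hstep t ((e t).symm v) j⟩
      out := fun v => out ((e n).symm v) }
  have hstate : ∀ x t, P.state x t = e t ⟨run step init x t, x, rfl⟩ := by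
    intro x t
    induction t with
    | zero =>
      have : Subsingleton (Fin (Nat.card (L 0))) := by rw [h0]; infer_instance
      exact Subsingleton.elim (α := Fin (Nat.card (L 0))) _ _
    | succ t ih =>
      simp only [state, ih]
      simp only [P, Equiv.symm_apply_apply]
      rfl
  refine ⟨P, ?_, ?_, fun t => rfl⟩
  · intro t _ v
    obtain ⟨x, hx⟩ := ((e t).symm v).2
    refine ⟨x, ?_⟩
    rw [hstate, ← (e t).apply_symm_apply v]
    exact congrArg _ (Subtype.ext hx)
  · intro x
    simp only [eval, hstate]
    exact congrArg (fun v : L n => out v) ((e n).symm_apply_apply _)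

end ROBP

/-- Lower by one every number exceeding the threshold `θ`. -/
def skipAbove (θ a : ℕ) : ℕ := if θ < a then a - 1 else a

lemma skipAbove_mono (θ : ℕ) {a b : ℕ} (h : a ≤ b) : skipAbove θ a ≤ skipAbove θ b := by
  unfold skipAbove
  split_ifs <;> omega

/-- A counter with increments `b`, which at time `t` skips one unit when it exceeds `θ t`. -/
def skipCount (θ b : ℕ → ℕ) : ℕ → ℕ
  | 0 => 0
  | t + 1 => skipAbove (θ t) (skipCount θ b t + b t)

section skipCount

variable {θ b : ℕ → ℕ}

lemma skipCount_mono {b' : ℕ → ℕ} (h : ∀ i, b i ≤ b' i) (t : ℕ) :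
    skipCount θ b t ≤ skipCount θ b' t := by
  induction t with
  | zero => exact le_rfl
  | succ t ih => exact skipAbove_mono _ (add_le_add ih (h t))

lemma skipCount_eq_zero (h : ∀ i, b i = 0) (t : ℕ) : skipCount θ b t = 0 := by
  induction t with
  | zero => rfl
  | succ t ih => simp [skipCount, ih, h, skipAbove]

lemma skipCount_le (h : ∀ i, b i ≤ 1) (t : ℕ) : skipCount θ b t ≤ t := by
  induction t with
  | zero => exact le_rfl
  | succ t ih =>
    have := h t
    simp only [skipCount, skipAbove]
    split_ifs <;> omega

lemma skipCount_eq_min {M t : ℕ} (hlow : ∀ i < M, i < θ i)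
    (hhigh : ∀ i < t, M ≤ i → θ i ≤ M) (h : ∀ i, b i = 1) :
    skipCount θ b t = min t M := by
  induction t with
  | zero => simp [skipCount]
  | succ t ih =>
    have h1 := hlow t
    have h2 := hhigh t (by omega)
    simp only [skipCount, skipAbove, h, ih fun i hi => hhigh i (by omega)]
    split_ifs <;> omega

lemma skipCount_add_le (h : ∀ i, b i ≤ 1) (t d : ℕ) :
    skipCount θ b (t + d) ≤ skipCount θ b t + d := by
  induction d with
  | zero => exact le_rfl
  | succ d ih =>
    have := h (t + d)
    rw [← add_assoc]
    simp only [skipCount, skipAbove]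
    split_ifs <;> omega

lemma le_skipCount_add (t d : ℕ) :
    skipCount θ b t ≤ skipCount θ b (t + d) + d := by
  induction d with
  | zero => exact le_rfl
  | succ d ih =>
    rw [← Nat.add_assoc t d 1]
    simp only [skipCount, skipAbove]
    split_ifs <;> omega

lemma sum_eq_skipCount_add_card (t : ℕ) :
    ∑ i ∈ range t, b i =
      skipCount θ b t + #{i ∈ range t | θ i < skipCount θ b i + b i} := by
  induction t with
  | zero => simp [skipCount]
  | succ t ih =>
    rw [sum_range_succ, ih, range_add_one, filter_insert]
    simp only [skipCount, skipAbove]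
    split_ifs
    · rw [card_insert_of_notMem (by simp)]
      omega
    · omega

/-- The lower estimate for the true count, given the final value `v` of a skipping counter whose
skips happen in the last `s` of `n` steps. -/
def skipEstimate (θ : ℕ → ℕ) (n s v : ℕ) : ℕ := v + #{i ∈ Ico (n - s) n | θ i + s < v}

/-- The true count is recovered from the final value of a skipping counter up to the largest
number `h` of thresholds in a window of length `2 * s`. -/
lemma sum_mem_Icc_skipEstimate {n s h : ℕ} (hsn : s ≤ n) (hb : ∀ i, b i ≤ 1)
    (hlow : ∀ i < n - s, i < θ i)
    (hwin : ∀ v, #{i ∈ Ico (n - s) n | v ≤ θ i + s ∧ θ i < v + s} ≤ h) :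
    skipEstimate θ n s (skipCount θ b n) ≤ ∑ i ∈ range n, b i ∧
      ∑ i ∈ range n, b i ≤ skipEstimate θ n s (skipCount θ b n) + h := by
  set v := skipCount θ b n with hv
  rw [sum_eq_skipCount_add_card (θ := θ), ← hv, skipEstimate]
  have hclose : ∀ i ∈ Ico (n - s) n,
      v ≤ skipCount θ b i + b i + s ∧ skipCount θ b i + b i ≤ v + s := by
    intro i hi
    rw [mem_Ico] at hi
    have hn : i + 1 + (n - (i + 1)) = n := by omega
    have h1 := skipCount_add_le (θ := θ) hb (i + 1) (n - (i + 1))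
    have h2 := le_skipCount_add (θ := θ) (b := b) (i + 1) (n - (i + 1))
    rw [hn, ← hv] at h1 h2
    simp only [skipCount, skipAbove] at h1 h2
    split_ifs at h1 h2 <;> omega
  constructor
  · refine Nat.add_le_add_left (card_le_card fun i hi => ?_) _
    rw [mem_filter] at hi ⊢
    have := hclose i hi.1
    have := mem_Ico.1 hi.1
    rw [mem_range]
    omega
  · rw [add_assoc]
    refine Nat.add_le_add_left (le_trans ?_ (Nat.add_le_add_left (hwin v) _)) _
    refine (card_le_card fun i hi => ?_).trans (card_union_le _ _)
    rw [mem_filter, mem_range] at hi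
    have hi' : i ∈ Ico (n - s) n := by
      rw [mem_Ico]
      refine ⟨?_, hi.1⟩
      by_contra hlt
      have := hlow i (by omega)
      have := skipCount_le (θ := θ) hb i
      have := hb i
      omega
    have := hclose i hi'
    rw [mem_union, mem_filter, mem_filter]
    by_cases hc : θ i + s < v
    · exact Or.inl ⟨hi', hc⟩
    · exact Or.inr ⟨hi', by omega, by omega⟩

end skipCount

/-- Thresholds which exceed the time before time `M`, and afterwards stay constant for `h` steps
before moving up by `d`. -/
def blockThreshold (M d h t : ℕ) : ℕ := if t < M then t + 1 else d * ((t - M) / h)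

lemma card_blockThreshold_window_le {n s h : ℕ} (hh : 0 < h) (v : ℕ) :
    #{i ∈ Ico (n - s) n | v ≤ blockThreshold (n - s) (2 * s) h i + s ∧
      blockThreshold (n - s) (2 * s) h i < v + s} ≤ h := by
  set M := n - s
  set A := {i ∈ Ico M n | v ≤ blockThreshold M (2 * s) h i + s ∧
    blockThreshold M (2 * s) h i < v + s} with hA
  have key : ∀ i ∈ A, M ≤ i ∧ v ≤ 2 * s * ((i - M) / h) + s ∧ 2 * s * ((i - M) / h) < v + s := by
    intro i hi
    rw [hA, mem_filter, mem_Ico] at hi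
    have : ¬ i < M := by omega
    simp only [blockThreshold, this, if_false] at hi
    exact ⟨hi.1.1, hi.2⟩
  rcases A.eq_empty_or_nonempty with h0 | ⟨i₀, hi₀⟩
  · simp [h0]
  have hsub : A ⊆ Ico (M + h * ((i₀ - M) / h)) (M + h * ((i₀ - M) / h) + h) := by
    intro i hi
    have h1 := key i hi
    have h2 := key i₀ hi₀
    have heq : (i - M) / h = (i₀ - M) / h := by
      by_contra hne
      rcases Nat.lt_or_gt_of_ne hne with hlt | hlt
      · have := Nat.mul_le_mul_left (2 * s) (Nat.succ_le_of_lt hlt)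
        rw [Nat.mul_succ] at this
        omega
      · have := Nat.mul_le_mul_left (2 * s) (Nat.succ_le_of_lt hlt)
        rw [Nat.mul_succ] at this
        omega
    have h3 := Nat.div_add_mod (i - M) h
    have h4 := Nat.mod_lt (i - M) hh
    rw [mem_Ico, ← heq]
    omega
  simpa using card_le_card hsub

/-- One step of the machine storing, for each `m`, a skipping counter for the letters `< m`. -/
def prefixStep {k : ℕ} (θ : ℕ → ℕ) (t : ℕ) (Q : ℕ → ℕ) (j : Fin k) : ℕ → ℕ :=
  fun m => skipAbove (θ t) (Q m + if (j : ℕ) < m then 1 else 0)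

lemma run_prefixStep {k : ℕ} (θ : ℕ → ℕ) (x : ℕ → Fin k) (t m : ℕ) :
    ROBP.run (prefixStep θ) 0 x t m =
      skipCount θ (fun i => if (x i : ℕ) < m then 1 else 0) t := by
  induction t with
  | zero => rfl
  | succ t ih => simp only [ROBP.run, skipCount, prefixStep, ih]

lemma sum_prefix_succ {k : ℕ} (x : ℕ → Fin k) (n : ℕ) (j : Fin k) :
    ∑ i ∈ range n, (if (x i : ℕ) < j + 1 then 1 else 0) =
      ∑ i ∈ range n, (if (x i : ℕ) < j then 1 else 0) + countK x n j := by
  rw [countK, card_filter, ← sum_add_distrib]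
  refine sum_congr rfl fun i _ => ?_
  simp only [Fin.ext_iff]
  split_ifs <;> omega

lemma ncard_range_run_prefixStep_le {k M t : ℕ} {θ : ℕ → ℕ} (hk : 0 < k)
    (hlow : ∀ i < M, i < θ i) (hhigh : ∀ i < t, M ≤ i → θ i ≤ M) :
    (Set.range fun x : ℕ → Fin k => ROBP.run (prefixStep θ) 0 x t).ncard ≤
      (M + k - 1).choose (k - 1) := by
  have hprop : ∀ x : ℕ → Fin k,
      Monotone (ROBP.run (prefixStep θ) 0 x t) ∧ ROBP.run (prefixStep θ) 0 x t 0 = 0 ∧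
        ∀ m, k ≤ m → ROBP.run (prefixStep θ) 0 x t m = min t M := by
    intro x
    refine ⟨fun m m' hm => ?_, ?_, fun m hm => ?_⟩
    · rw [run_prefixStep, run_prefixStep]
      refine skipCount_mono (fun i => ?_) t
      split_ifs <;> omega
    · rw [run_prefixStep]
      exact skipCount_eq_zero (by simp) t
    · rw [run_prefixStep]
      exact skipCount_eq_min hlow hhigh (fun i => if_pos ((x i).2.trans_le hm))
  let T : Set (Fin k → ℕ) := {f | ∑ i, f i = min t M}
  have hcard : T.ncard = (min t M + k - 1).choose (k - 1) := by
    change Nat.card {f : Fin k → ℕ // ∑ i, f i = min t M} = _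
    rw [← Nat.card_congr (Sym.equivNatSumOfFintype (Fin k) (min t M)), Nat.card_eq_fintype_card,
      Sym.card_sym_eq_choose, Fintype.card_fin, Nat.choose_symm_of_eq_add (b := k - 1) (by omega),
      add_comm k]
  have hTfin : T.Finite :=
    (Finite.of_equiv _ (Sym.equivNatSumOfFintype (Fin k) (min t M)) :
      Finite {f : Fin k → ℕ // ∑ i, f i = min t M})
  calc _ ≤ T.ncard := by
        refine Set.ncard_le_ncard_of_injOn (fun Q (i : Fin k) => Q (i + 1) - Q i) ?_ ?_ hTfin
        · rintro _ ⟨x, rfl⟩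
          obtain ⟨hm, h0, hlast⟩ := hprop x
          change ∑ i : Fin k, _ = _
          rw [Fin.sum_univ_eq_sum_range
            (fun i => ROBP.run (prefixStep θ) 0 x t (i + 1) - ROBP.run (prefixStep θ) 0 x t i) k,
            sum_range_tsub hm, h0, hlast k le_rfl, Nat.sub_zero]
        · rintro _ ⟨x, rfl⟩ _ ⟨y, rfl⟩ hxy
          obtain ⟨hm, h0, hlast⟩ := hprop x
          obtain ⟨hm', h0', hlast'⟩ := hprop y
          funext m
          induction m with
          | zero => exact h0.trans h0'.symm
          | succ m ih =>
            by_cases hmk : m < k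
            · have h1 := congrFun hxy ⟨m, hmk⟩
              have h2 := hm (Nat.le_succ m)
              have h3 := hm' (Nat.le_succ m)
              simp only [Nat.succ_eq_add_one] at h1 h2 h3 ih ⊢
              omega
            · exact (hlast _ (by omega)).trans (hlast' _ (by omega)).symm
    _ ≤ _ := by
        rw [hcard]
        exact Nat.choose_le_choose _ (by omega)

lemma choose_le_genChoose {N m : ℕ} {x : ℝ} (hm : m ≤ N + 1) (hx : (N : ℝ) ≤ x) :
    (N.choose m : ℝ) ≤ genChoose x m := by
  have hfac : (0 : ℝ) < m.factorial := by exact_mod_cast m.factorial_pos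
  rw [genChoose, le_div_iff₀ hfac, mul_comm]
  have h := Nat.descFactorial_eq_factorial_mul_choose N m
  rw [Nat.descFactorial_eq_prod_range] at h
  rw [← Nat.cast_mul, ← h, Nat.cast_prod]
  refine prod_le_prod (fun i _ => Nat.cast_nonneg _) fun i hi => ?_
  rw [mem_range] at hi
  rw [Nat.cast_sub (by omega)]
  linarith

/-- If `s` steps are skipped, with thresholds moving by `2 * s` every `h` steps and staying below
`n - s`, then all counts are approximated within `h`. -/
theorem exists_approxCount {k n s h : ℕ} (hk : 0 < k) (hsn : s ≤ n) (hh : 0 < h)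
    (hroom : 2 * s * ((s - 1) / h) ≤ n - s) :
    ∃ P : ROBP (Fin k) (Fin k → ℝ) n, P.Reachable ∧ ComputesApproxCountK k n h P ∧
      P.width ≤ (n - s + k - 1).choose (k - 1) := by
  have : Nonempty (Fin k) := ⟨⟨0, hk⟩⟩
  set θ := blockThreshold (n - s) (2 * s) h with hθ
  have hlow : ∀ i < n - s, i < θ i := by
    intro i hi
    simp [hθ, blockThreshold, hi]
  have hhigh : ∀ i < n, n - s ≤ i → θ i ≤ n - s := by
    intro i hi hi'
    simp only [hθ, blockThreshold, not_lt.2 hi', if_false]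
    exact (Nat.mul_le_mul_left _ (Nat.div_le_div_right (by omega))).trans hroom
  let E := skipEstimate θ n s
  obtain ⟨P, hreach, heval, hsize⟩ := ROBP.exists_of_run (n := n) (prefixStep (k := k) θ) 0
    fun Q (j : Fin k) => (E (Q (j + 1)) : ℝ) - E (Q j)
  refine ⟨P, hreach, fun x j => ?_, ?_⟩
  · have hb : ∀ m i, (if (x i : ℕ) < m then 1 else 0) ≤ 1 := by
      intro m i
      split_ifs <;> omega
    have herr := fun m => sum_mem_Icc_skipEstimate hsn (hb m) hlow
      (card_blockThreshold_window_le hh)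
    obtain ⟨h1, h2⟩ := herr (j + 1)
    obtain ⟨h3, h4⟩ := herr j
    rw [sum_prefix_succ] at h1 h2
    simp only [heval, run_prefixStep, E]
    generalize skipEstimate θ n s _ = a at h1 h2 ⊢
    generalize skipEstimate θ n s _ = b at h3 h4 ⊢
    generalize (∑ i ∈ range n, if (x i : ℕ) < j then 1 else 0) = S at h1 h2 h3 h4
    rw [abs_le]
    rify at h1 h2 h3 h4
    constructor <;> linarith
  · refine Finset.sup_le fun t ht => ?_
    rw [mem_range] at ht
    rw [hsize]
    exact ncard_range_run_prefixStep_le hk hlow fun i hi => hhigh i (by omega)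

/-- there is an absolute constant `c > 0` such that for all `k ≥ 2`,
`n ≥ 10k` and `10 ≤ Δ ≤ n/10`, there is a length-`n` ROBP over `[k]` computing
`ApproxCount_k[n, Δ]` of width at most `C(n + k - 1 - c·√(nΔ), k-1)`. -/
theorem stmt15 :
    ∃ c : ℝ, 0 < c ∧
      ∀ k n : ℕ, 2 ≤ k → 10 * k ≤ n →
        ∀ Δ : ℝ, 10 ≤ Δ → Δ ≤ (n : ℝ) / 10 →
          ∃ P : ROBP (Fin k) (Fin k → ℝ) n, P.Reachable ∧
            ComputesApproxCountK k n Δ P ∧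
            (P.width : ℝ) ≤
              genChoose ((n : ℝ) + (k : ℝ) - 1 - c * Real.sqrt ((n : ℝ) * Δ)) (k - 1) := by
  refine ⟨1 / 4, by norm_num, fun k n hk hn Δ hΔ hΔn => ?_⟩
  set r := Real.sqrt ((n : ℝ) * Δ)
  set s := ⌈1 / 4 * r⌉₊
  set h := ⌊Δ⌋₊
  have hn' : (20 : ℝ) ≤ n := by exact_mod_cast (show 20 ≤ n by omega)
  have hr0 : 0 ≤ r := Real.sqrt_nonneg _
  have hr2 : r ^ 2 = n * Δ := Real.sq_sqrt (by positivity)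
  have hrn : r ≤ n / 3 := by nlinarith
  have hs1 : 1 / 4 * r ≤ s := Nat.le_ceil _
  have hs2 : (s : ℝ) < 1 / 4 * r + 1 := Nat.ceil_lt_add_one (by positivity)
  have hh1 : (h : ℝ) ≤ Δ := Nat.floor_le (by linarith)
  have hh2 : Δ < h + 1 := Nat.lt_floor_add_one Δ
  have hh0 : 0 < h := by
    have : (0 : ℝ) < h := by linarith
    exact_mod_cast this
  have hsn : s ≤ n := by
    have : (s : ℝ) ≤ n := by linarith
    exact_mod_cast this
  have hroom : 2 * s * ((s - 1) / h) ≤ n - s := by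
    have hmul : (2 * s * ((s - 1) / h) + s) * h ≤ n * h := by
      have h1 : (s - 1) / h * h ≤ s := (Nat.div_mul_le_self _ _).trans (by omega)
      have h2 : 2 * s * s + s * h ≤ n * h := by
        have : 2 * (s : ℝ) * s + s * h ≤ n * h := by nlinarith
        exact_mod_cast this
      nlinarith
    have := Nat.le_of_mul_le_mul_right hmul hh0
    omega
  obtain ⟨P, hreach, hcomp, hwidth⟩ := exists_approxCount (by omega : 0 < k) hsn hh0 hroom
  refine ⟨P, hreach, fun x j => (hcomp x j).trans hh1, ?_⟩
  refine (Nat.cast_le.2 hwidth).trans (choose_le_genChoose (by omega) ?_)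
  rw [Nat.cast_sub (by omega), Nat.cast_add, Nat.cast_sub hsn]
  push_cast
  linarith
end
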